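/- arXiv:1804.11074 — 2 statements merged into one kernel-verified Lean document; each statement's English description precedes it below -/
import Mathlib

section
/- Let A be a p × q real matrix that is totally unimodular, let b ∈ ℤ^p, let r be a positive integer, let j : {1,…,r} → {1,…,q} be a map, and let c ∈ ℤ^r. Define the polyhedron S := {(x, u) ∈ ℝ^q × ℝ^r : A x = b, x ≥ 0 componentwise, and for every i ∈ {1,…,r}, u_i ≥ 0 and u_i ≥ c_i − x_{j(i)}}. Then every extreme point of S has all coordinates in ℤ, i.e., every extreme point of S lies in ℤ^q × ℤ^r. -/
open Filter Topology

/-- If `z + t • v` stays in `S` for all small `t`, then `v = 0` when `z` is an extreme point. -/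
lemma eq_zero_of_mem_extremePoints_of_eventually {E : Type*} [AddCommGroup E] [Module ℝ E]
    {S : Set E} {z v : E} (hz : z ∈ Set.extremePoints ℝ S)
    (h : ∀ᶠ t in 𝓝 (0 : ℝ), z + t • v ∈ S) : v = 0 := by
  have hneg : ∀ᶠ t in 𝓝 (0 : ℝ), z + (-t) • v ∈ S := by
    have : Tendsto (fun t : ℝ => -t) (𝓝 0) (𝓝 0) := by
      simpa using (continuous_neg (G := ℝ)).tendsto 0
    exact this.eventually h
  obtain ⟨t, ⟨h₁, h₂⟩, ht⟩ :=
    (((h.and hneg).filter_mono nhdsWithin_le_nhds).and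
      (self_mem_nhdsWithin : Set.Ioi (0 : ℝ) ∈ 𝓝[>] 0)).exists
  have hseg : z ∈ openSegment ℝ (z + t • v) (z + (-t) • v) :=
    ⟨1 / 2, 1 / 2, by norm_num, by norm_num, by norm_num, by module⟩
  have heq : z + t • v = z := hz.2 h₁ h₂ hseg
  have htv : t • v = 0 := by simpa using heq
  exact (smul_eq_zero.mp htv).resolve_left (ne_of_gt ht)

/-- An affine function of `t` which is nonnegative at `0`, and constant if it vanishes there,
is nonnegative for all small `t`. -/
lemma eventually_nonneg_add_mul {a e : ℝ} (ha : 0 ≤ a) (h : a = 0 → e = 0) :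
    ∀ᶠ t in 𝓝 (0 : ℝ), 0 ≤ a + t * e := by
  rcases ha.eq_or_lt with h0 | h0
  · simp [h h0.symm, ha]
  · have : Tendsto (fun t : ℝ => a + t * e) (𝓝 0) (𝓝 a) := by
      have hc : Continuous (fun t : ℝ => a + t * e) := by fun_prop
      simpa using hc.tendsto 0
    exact (this.eventually (lt_mem_nhds h0)).mono fun _ => le_of_lt

namespace Matrix

/-- A matrix over a field whose columns are linearly independent has an invertible square
submatrix using all the columns. -/
lemma exists_isUnit_submatrix_of_mulVec_injective {m n K : Type*} [Field K] [Fintype m]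
    [Fintype n] [DecidableEq n] (A : Matrix m n K) (hA : Function.Injective A.mulVec) :
    ∃ f : n → m, IsUnit (A.submatrix f id) := by
  have hrank : A.rank = Fintype.card n := by
    rw [← rank_transpose]
    exact LinearIndependent.rank_matrix (M := Aᵀ) (mulVec_injective_iff.mp hA)
  have hspan : Submodule.span K (Set.range A.row) = ⊤ := by
    apply Submodule.eq_top_of_finrank_eq
    rw [← rank_eq_finrank_span_row, hrank, Module.finrank_fintype_fun_eq_card]
  let B := Module.Basis.ofSpan hspan.ge
  have hB : ∀ k, ∃ i, A.row i = B k :=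
    fun k => Module.Basis.ofSpan_subset hspan.ge ⟨k, rfl⟩
  choose f hf using hB
  let e := B.indexEquiv (Pi.basisFun K n)
  refine ⟨f ∘ e.symm, linearIndependent_rows_iff_isUnit.mp ?_⟩
  have : (A.submatrix (f ∘ e.symm) id).row = B ∘ e.symm := by
    funext k
    exact hf (e.symm k)
  rw [this]
  exact B.linearIndependent.comp _ e.symm.injective

/-- The unique solution of an integral linear system with a totally unimodular matrix of full
column rank is integral. -/
lemma IsTotallyUnimodular.exists_int_of_mulVec_eq {m n : Type*} [Fintype m] [Fintype n]
    {A : Matrix m n ℝ} (hA : A.IsTotallyUnimodular) (hinj : Function.Injective A.mulVec)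
    {x : n → ℝ} (hx : ∀ i, ∃ k : ℤ, A.mulVec x i = k) (i : n) : ∃ k : ℤ, x i = k := by
  classical
  obtain ⟨f, hf⟩ := A.exists_isUnit_submatrix_of_mulVec_injective hinj
  choose v hv using hx
  choose s hs using hA.apply
  let M : Matrix n n ℤ := of fun k l => (s (f k) l : ℤ)
  have hM : A.submatrix f id = (Int.castRingHom ℝ).mapMatrix M := by
    ext k l
    simp [M, hs]
  have hMx : (A.submatrix f id).mulVec x = fun k => (v (f k) : ℝ) := by
    funext k
    exact hv (f k)
  have hadj : (A.submatrix f id).det * x i =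
      ((∑ k, M.adjugate i k * v (f k) : ℤ) : ℝ) := by
    have h := congrFun (congrArg (A.submatrix f id).adjugate.mulVec hMx) i
    rw [mulVec_mulVec, adjugate_mul, smul_mulVec, one_mulVec, Pi.smul_apply, smul_eq_mul] at h
    rw [h, hM, ← RingHom.map_adjugate]
    simp [mulVec, dotProduct]
  obtain ⟨d, hd⟩ := (isTotallyUnimodular_iff_fintype A).mp hA n f id
  have hdet : (A.submatrix f id).det ≠ 0 := ((isUnit_iff_isUnit_det _).mp hf).ne_zero
  rw [← hd] at hadj hdet
  cases d with
  | zero => simp at hdet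
  | pos => exact ⟨∑ k, M.adjugate i k * v (f k), by simpa using hadj⟩
  | neg =>
    refine ⟨-∑ k, M.adjugate i k * v (f k), ?_⟩
    rw [Int.cast_neg, ← hadj]
    simp

end Matrix

/-- Integrality of extreme points of the TU rebalancing polyhedron.
Let `A` be a `p × q` totally unimodular real matrix, `b ∈ ℤ^p`, `r ≥ 1`, `j : Fin r → Fin q`,
and `c ∈ ℤ^r`. Consider the polyhedron
`S = {(x, u) : A x = b, x ≥ 0, ∀ i, u i ≥ 0 ∧ u i ≥ c i − x (j i)}`.
Then every extreme point of `S` has all coordinates in `ℤ`. -/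
theorem extremePoints_integral_of_totallyUnimodular (p q r : ℕ) (hr : 0 < r)
    (A : Matrix (Fin p) (Fin q) ℝ) (hA : A.IsTotallyUnimodular)
    (b : Fin p → ℤ) (j : Fin r → Fin q) (c : Fin r → ℤ) :
    ∀ z ∈ Set.extremePoints ℝ
        {zu : (Fin q → ℝ) × (Fin r → ℝ) |
          A.mulVec zu.1 = (fun i => (b i : ℝ)) ∧ (∀ i, 0 ≤ zu.1 i) ∧
            ∀ i, 0 ≤ zu.2 i ∧ (c i : ℝ) - zu.1 (j i) ≤ zu.2 i},
      (∀ i, ∃ n : ℤ, z.1 i = (n : ℝ)) ∧ (∀ i, ∃ n : ℤ, z.2 i = (n : ℝ)) := by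
  classical
  rintro ⟨x, u⟩ hz
  obtain ⟨hAx, hx, hu⟩ := hz.1
  dsimp only at hAx hx hu
  have hdir : ∀ (d : Fin q → ℝ) (e : Fin r → ℝ), A.mulVec d = 0 → (∀ i, x i = 0 → d i = 0) →
      (∀ i, u i = 0 → e i = 0) → (∀ i, u i + x (j i) - c i = 0 → e i + d (j i) = 0) →
      d = 0 ∧ e = 0 := by
    intro d e hd hxd hue hcd
    have hev : ∀ᶠ t in 𝓝 (0 : ℝ), (∀ i, 0 ≤ x i + t * d i) ∧ (∀ i, 0 ≤ u i + t * e i) ∧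
        ∀ i, 0 ≤ (u i + x (j i) - c i) + t * (e i + d (j i)) := by
      simp only [eventually_and, eventually_all]
      exact ⟨fun i => eventually_nonneg_add_mul (hx i) (hxd i),
        fun i => eventually_nonneg_add_mul (hu i).1 (hue i),
        fun i => eventually_nonneg_add_mul (by linarith [(hu i).2]) (hcd i)⟩
    have hzero := eq_zero_of_mem_extremePoints_of_eventually (v := (d, e)) hz
      (hev.mono fun t ⟨h₁, h₂, h₃⟩ => by
        refine ⟨?_, h₁, fun i => ⟨h₂ i, ?_⟩⟩
        · simp [Matrix.mulVec_add, Matrix.mulVec_smul, hd, hAx]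
        · have := h₃ i
          simp only [Prod.fst_add, Prod.snd_add, Prod.smul_fst, Prod.smul_snd, Pi.add_apply,
            Pi.smul_apply, smul_eq_mul]
          linarith)
    simpa using hzero
  let P : Fin q → Prop := fun i => ¬ ∃ n : ℤ, x i = n
  let A' : Matrix (Fin p) {i // P i} ℝ := A.submatrix id Subtype.val
  have hsplit : ∀ (d : Fin q → ℝ) k, A.mulVec d k =
      A'.mulVec (fun i => d i) k + ∑ i : {i // ¬ P i}, A k i * d i := fun d k =>
    (Fintype.sum_subtype_add_sum_subtype P fun i => A k i * d i).symm
  have hinj : Function.Injective A'.mulVec := by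
    rw [← Matrix.coe_mulVecLin, injective_iff_map_eq_zero]
    intro y hy
    rw [Matrix.mulVecLin_apply] at hy
    let d : Fin q → ℝ := fun i => if h : P i then y ⟨i, h⟩ else 0
    have hdP : ∀ i, ¬ P i → d i = 0 := fun i h => dif_neg h
    have hdy : (fun i : {i // P i} => d i) = y := by
      funext i
      exact dif_pos i.2
    have hAd : A.mulVec d = 0 := by
      funext k
      rw [hsplit, hdy, hy]
      simp only [Pi.zero_apply, zero_add]
      exact Finset.sum_eq_zero fun i _ => by rw [hdP i i.2, mul_zero]
    have hd := (hdir d (fun i => if u i + x (j i) - c i = 0 then -d (j i) else 0) hAd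
      (fun i hi => hdP i fun h => h ⟨0, by simpa using hi⟩)
      (fun i hi => by
        split_ifs with h
        · rw [hdP (j i) fun hP => hP ⟨c i, by linarith⟩, neg_zero]
        · rfl)
      (fun i hi => by simp [hi])).1
    rw [← hdy, hd]
    rfl
  have hxint : ∀ i, ∃ n : ℤ, x i = n := by
    intro i
    by_contra hi
    refine hi ((hA.submatrix id Subtype.val).exists_int_of_mulVec_eq hinj
      (x := fun i => x i) (fun k => ?_) ⟨i, hi⟩)
    choose s hs using hA.apply
    choose n hn using fun i : {i // ¬ P i} => not_not.mp i.2
    refine ⟨b k - ∑ i : {i // ¬ P i}, (s k i : ℤ) * n i, ?_⟩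
    have h := hsplit x k
    rw [hAx] at h
    rw [← sub_eq_iff_eq_add] at h
    rw [← h]
    simp [← hs, hn]
  refine ⟨hxint, fun i => ?_⟩
  by_contra hi
  have he := (hdir 0 (Pi.single i 1) (Matrix.mulVec_zero A) (fun _ _ => rfl)
    (fun k hk => Pi.single_eq_of_ne (by rintro rfl; exact hi ⟨0, by simpa using hk⟩) _)
    (fun k hk => by
      rw [Pi.zero_apply, add_zero]
      refine Pi.single_eq_of_ne ?_ _
      rintro rfl
      obtain ⟨n, hn⟩ := hxint (j k)
      exact hi ⟨c k - n, by push_cast; linarith⟩)).2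
  simpa using congrFun he i
end

section
/- Let A be a p × q real matrix, b ∈ ℝ^p, r a positive integer, j : {1,…,r} → {1,…,q} a map, and c ∈ ℝ^r. Define the polyhedron S := {(x, u) ∈ ℝ^q × ℝ^r : A x = b, x ≥ 0 componentwise, and for every i ∈ {1,…,r}, u_i ≥ 0 and u_i ≥ c_i − x_{j(i)}}. If (x, u) is an extreme point of S, then for every i ∈ {1,…,r}, either u_i = 0 or u_i = c_i − x_{j(i)}. -/
/-- Active constraints at extreme points. Let `A` be a `p × q` real matrix,
`b ∈ ℝ^p`, `r ≥ 1`, `j : Fin r → Fin q`, and `c ∈ ℝ^r`. Consider the polyhedron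
`S = {(x, u) : A x = b, x ≥ 0, ∀ i, u i ≥ 0 ∧ u i ≥ c i − x (j i)}`.
If `(x, u)` is an extreme point of `S`, then for every `i` either `u i = 0` or
`u i = c i − x (j i)`. -/
theorem extremePoint_active_constraints (p q r : ℕ) (hr : 0 < r)
    (A : Matrix (Fin p) (Fin q) ℝ) (b : Fin p → ℝ) (j : Fin r → Fin q) (c : Fin r → ℝ) :
    ∀ z ∈ Set.extremePoints ℝ
        {zu : (Fin q → ℝ) × (Fin r → ℝ) |
          A.mulVec zu.1 = b ∧ (∀ i, 0 ≤ zu.1 i) ∧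
            ∀ i, 0 ≤ zu.2 i ∧ c i - zu.1 (j i) ≤ zu.2 i},
      ∀ i, z.2 i = 0 ∨ z.2 i = c i - z.1 (j i) := by
  rintro ⟨x, u⟩ hz i
  obtain ⟨⟨hA, hx, hu⟩, hext⟩ := mem_extremePoints_iff_left.1 hz
  dsimp only at hA hx hu ⊢
  by_contra! hne
  obtain ⟨hu₀, huc⟩ := hu i
  obtain ⟨ε, hε, hε₀, hεc⟩ : ∃ ε, 0 < ε ∧ ε ≤ u i ∧ ε ≤ u i - (c i - x (j i)) :=
    ⟨min (u i) (u i - (c i - x (j i))),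
      lt_min (lt_of_le_of_ne hu₀ hne.1.symm) (sub_pos.2 (lt_of_le_of_ne huc hne.2.symm)),
      min_le_left _ _, min_le_right _ _⟩
  have feasible (t : ℝ) (ht : -ε ≤ t) (k : Fin r) :
      0 ≤ Function.update u i (u i + t) k ∧
        c k - x (j k) ≤ Function.update u i (u i + t) k := by
    rcases eq_or_ne k i with rfl | hk
    · simp only [Function.update_self]
      constructor <;> linarith
    · simpa only [Function.update_of_ne hk] using hu k
  have h := hext (x, Function.update u i (u i + ε)) ⟨hA, hx, feasible ε (by linarith)⟩
    (x, Function.update u i (u i + -ε)) ⟨hA, hx, feasible (-ε) le_rfl⟩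
    ⟨1 / 2, 1 / 2, by norm_num, by norm_num, by norm_num, by
      ext k
      · simp only [Prod.fst_add, Prod.smul_fst, Pi.add_apply, Pi.smul_apply, smul_eq_mul]
        ring
      · simp only [Prod.snd_add, Prod.smul_snd, Pi.add_apply, Pi.smul_apply, smul_eq_mul]
        rcases eq_or_ne k i with rfl | hk
        · simp only [Function.update_self]
          ring
        · simp only [Function.update_of_ne hk]
          ring⟩
  have hi := congrFun (congrArg Prod.snd h) i
  simp only [Function.update_self] at hi
  linarith
end
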